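/- Fix an integer w ≥ 1 and two partitions σ, σ' of {1,...,2w} all of whose blocks have even size. For each n, let H ∈ ℝ^{n×n} be a deterministic orthogonal matrix satisfying, for every fixed ε > 0 and all large n, max_{i,j} |H[i,j]| < n^{−1/2+ε}. Then there exists a value H(σ,σ') ∈ {0,1}, depending only on σ and σ' (and not on the sequence of matrices H), such that lim_{n→∞} n^{−|σ∨σ'|} Σ_{k ∈ [n]^{2w}: π(k) ≥ σ} Σ_{l ∈ [n]^{2w}: π(l) ≥ σ'} Π_{ρ=1}^{2w} H[k_ρ, l_ρ] = H(σ,σ'). -/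

import Mathlib

open MeasureTheory ProbabilityTheory Filter

noncomputable section

/-- A `Bool`-valued equivalence relation on `Fin m`, encoding a partition of `{1, …, m}`. -/
def IsPartitionRel {m : ℕ} (r : Fin m → Fin m → Bool) : Prop :=
  (∀ a, r a a = true) ∧ (∀ a b, r a b = r b a) ∧
    ∀ a b c, r a b = true → r b c = true → r a c = true

/-- The blocks of the partition encoded by `r`, as a finite set of finite sets. -/
def blockFinsets {m : ℕ} (r : Fin m → Fin m → Bool) : Finset (Finset (Fin m)) :=
  Finset.univ.image fun a => Finset.univ.filter fun b => r a b = true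

/-- The number of blocks of the join (least common coarsening) of the partitions
encoded by `r` and `r'`. -/
def joinCard {m : ℕ} (r r' : Fin m → Fin m → Bool) : ℕ :=
  Nat.card (Quot fun a b : Fin m => r a b = true ∨ r' a b = true)

/-- `H` is an orthogonal matrix. -/
def isOrthogonalMat {n : ℕ} (H : Fin n → Fin n → ℝ) : Prop :=
  ∀ i j : Fin n, (∑ l, H i l * H j l) = if i = j then (1 : ℝ) else 0

/-- The sum over all vertex labellings `k : V → Fin n` of the product of the entries
`H (k e.1) (k e.2)` over the edges `e` of a multigraph. -/
def edgeSum {V : Type} [Fintype V] [DecidableEq V] {n : ℕ} (H : Fin n → Fin n → ℝ)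
    (E : Multiset (V × V)) : ℝ :=
  ∑ k : V → Fin n, (E.map fun e => H (k e.1) (k e.2)).prod

/-- The identity matrix as a function of two indices. -/
def idMat (n : ℕ) : Fin n → Fin n → ℝ := fun i j => if i = j then 1 else 0

/-- A sequence of orthogonal matrices whose entries are `O(n ^ (-1/2 + ε))` for every `ε > 0`. -/
def IsDelocalized (H : ∀ n : ℕ, Fin n → Fin n → ℝ) : Prop :=
  (∀ n : ℕ, isOrthogonalMat (H n)) ∧
    ∀ ε : ℝ, 0 < ε → ∀ᶠ n in atTop, ∀ i j : Fin n, |H n i j| < (n : ℝ) ^ (-(1 / 2 : ℝ) + ε)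

/-- Every vertex is the first endpoint of an even number of edges and the second endpoint of an
even number of edges. -/
def HasEvenDegrees {V : Type} (E : Multiset (V × V)) : Prop :=
  ∀ g : V → ZMod 2, (E.map fun e => g e.1).sum = 0 ∧ (E.map fun e => g e.2).sum = 0

lemma isOrthogonalMat_idMat (n : ℕ) : isOrthogonalMat (idMat n) := by
  intro i j
  simp [idMat]

lemma isOrthogonalMat.transpose {n : ℕ} {H : Fin n → Fin n → ℝ} (h : isOrthogonalMat H) :
    isOrthogonalMat fun i j => H j i := by
  have h1 : (Matrix.of H) * (Matrix.of H).transpose = 1 := by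
    ext i j
    simpa [Matrix.mul_apply, Matrix.one_apply] using h i j
  have h2 := mul_eq_one_comm.mp h1
  intro i j
  simpa [Matrix.mul_apply, Matrix.one_apply] using congrFun (congrFun h2 i) j

lemma IsDelocalized.transpose {H : ∀ n : ℕ, Fin n → Fin n → ℝ} (h : IsDelocalized H) :
    IsDelocalized fun n i j => H n j i :=
  ⟨fun n => (h.1 n).transpose, fun ε hε => (h.2 ε hε).mono fun _ hn i j => hn j i⟩

lemma idMat_transpose (n : ℕ) : (fun i j => idMat n j i) = idMat n := by
  ext i j
  simp [idMat, eq_comm]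

lemma abs_prod_edges_le {V : Type} {n : ℕ} {H : Fin n → Fin n → ℝ} {M : ℝ}
    (hM : ∀ i j, |H i j| ≤ M) (k : V → Fin n) (E : Multiset (V × V)) :
    |(E.map fun e => H (k e.1) (k e.2)).prod| ≤ M ^ E.card := by
  induction E using Multiset.induction_on with
  | empty => simp
  | cons e E ih =>
    rw [Multiset.map_cons, Multiset.prod_cons, abs_mul, Multiset.card_cons, pow_succ']
    exact mul_le_mul (hM _ _) ih (abs_nonneg _) ((abs_nonneg _).trans (hM (k e.1) (k e.2)))

lemma HasEvenDegrees.swap {V : Type} {E : Multiset (V × V)} (h : HasEvenDegrees E) :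
    HasEvenDegrees (E.map Prod.swap) := fun g => by
  simpa [Multiset.map_map] using (h g).symm

lemma exists_eq_cons_cons {V : Type} [DecidableEq V] {E : Multiset (V × V)} {x : V}
    (h : (E.map Prod.snd).count x = 2) :
    ∃ u v R, E = (u, x) ::ₘ (v, x) ::ₘ R ∧ ∀ e ∈ R, e.2 ≠ x := by
  have key : ∀ {F : Multiset (V × V)} {c : ℕ}, (F.map Prod.snd).count x = c + 1 →
      ∃ u R, F = (u, x) ::ₘ R ∧ (R.map Prod.snd).count x = c := by
    intro F c hF
    have hx : x ∈ F.map Prod.snd := Multiset.count_pos.mp (by omega)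
    obtain ⟨⟨u, y⟩, he, hy⟩ := Multiset.mem_map.mp hx
    obtain rfl : y = x := hy
    obtain ⟨R, rfl⟩ := Multiset.exists_cons_of_mem he
    refine ⟨u, R, rfl, ?_⟩
    simpa using hF
  obtain ⟨u, R₁, rfl, h₁⟩ := key h
  obtain ⟨v, R, rfl, h₂⟩ := key h₁
  exact ⟨u, v, R, rfl, fun e he hx =>
    Multiset.count_eq_zero.mp h₂ (hx ▸ Multiset.mem_map_of_mem Prod.snd he)⟩

section

variable {V : Type} [Fintype V] [DecidableEq V]

lemma edgeSum_map_swap {n : ℕ} (H : Fin n → Fin n → ℝ) (E : Multiset (V × V)) :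
    edgeSum (fun i j => H j i) (E.map Prod.swap) = edgeSum H E := by
  simp [edgeSum, Multiset.map_map]

lemma sum_mul_card_eq_sum_update {n : ℕ} (f : (V → Fin n) → ℝ) (x : V) :
    (∑ k, f k) * n = ∑ k, ∑ a, f (Function.update k x a) := by
  have h1 : (∑ k, f k) * n = ∑ q : (V → Fin n) × Fin n, f q.1 := by
    rw [Fintype.sum_prod_type]
    simp [Finset.sum_mul, mul_comm (n : ℝ)]
  rw [h1, ← Fintype.sum_prod_type' (f := fun k a => f (Function.update k x a))]
  refine Finset.sum_nbij' (fun q => (Function.update q.1 x q.2, q.1 x))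
    (fun q => (Function.update q.1 x q.2, q.1 x)) ?_ ?_ ?_ ?_ ?_ <;> simp

/-- The orthogonality relation contracts two edges `(u, x)` and `(v, x)` when `x` is not an
endpoint of any other edge. -/
lemma edgeSum_contract_mul {n : ℕ} {H : Fin n → Fin n → ℝ} (hH : isOrthogonalMat H)
    (R : Multiset (V × V)) (u v x : V) (hu : u ≠ x) (hv : v ≠ x)
    (hR : ∀ e ∈ R, e.1 ≠ x ∧ e.2 ≠ x) :
    edgeSum H ((u, x) ::ₘ (v, x) ::ₘ R) * n =
      ∑ k : V → Fin n, (if k u = k v then 1 else 0) *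
        (R.map fun e => H (k e.1) (k e.2)).prod := by
  rw [edgeSum, sum_mul_card_eq_sum_update _ x]
  refine Finset.sum_congr rfl fun k _ => ?_
  have h : ∀ a, (R.map fun e => H (Function.update k x a e.1) (Function.update k x a e.2)) =
      R.map fun e => H (k e.1) (k e.2) := fun a => Multiset.map_congr rfl fun e he => by
    rw [Function.update_of_ne (hR e he).1, Function.update_of_ne (hR e he).2]
  simp only [Multiset.map_cons, Multiset.prod_cons, h, Function.update_self,
    Function.update_of_ne hu, Function.update_of_ne hv, ← mul_assoc]
  rw [← Finset.sum_mul, hH]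

lemma sum_ite_eq_mul_card {n : ℕ} (F : (V → Fin n) → ℝ) {u v : V} (huv : u ≠ v) :
    (∑ k : V → Fin n, (if k u = k v then 1 else 0) * F k) * n =
      ∑ k : V → Fin n, F fun y => k (Function.update id v u y) := by
  rw [sum_mul_card_eq_sum_update _ v]
  refine Finset.sum_congr rfl fun k _ => ?_
  simp only [Function.update_self, Function.update_of_ne huv, ite_mul, one_mul, zero_mul,
    Finset.sum_ite_eq, Finset.mem_univ, if_true]
  congr 1
  ext y
  by_cases hy : y = v
  · subst hy; simp
  · simp [hy]

lemma exists_edgeSum_contract (R : Multiset (V × V)) (u v x : V) (hu : u ≠ x) (hv : v ≠ x)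
    (hR : ∀ e ∈ R, e.1 ≠ x ∧ e.2 ≠ x) :
    ∃ j : ℕ, ∀ (n : ℕ) (H : Fin n → Fin n → ℝ), isOrthogonalMat H →
      edgeSum H ((u, x) ::ₘ (v, x) ::ₘ R) * (n : ℝ) ^ j =
        edgeSum H (R.map (Prod.map (Function.update id v u) (Function.update id v u))) := by
  by_cases huv : u = v
  · subst huv
    have hid : Function.update (id : V → V) u u = id := Function.update_eq_self u id
    refine ⟨1, fun n H hH => ?_⟩
    rw [pow_one, edgeSum_contract_mul hH R u u x hu hv hR]
    simp [edgeSum, hid]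
  · refine ⟨2, fun n H hH => ?_⟩
    rw [pow_two, ← mul_assoc, edgeSum_contract_mul hH R u v x hu hv hR,
      sum_ite_eq_mul_card (fun k => (R.map fun e => H (k e.1) (k e.2)).prod) huv]
    simp [edgeSum, Multiset.map_map]

lemma abs_edgeSum_le {n : ℕ} {H : Fin n → Fin n → ℝ} {M : ℝ} (hM : ∀ i j, |H i j| ≤ M)
    (E : Multiset (V × V)) :
    |edgeSum H E| ≤ (n : ℝ) ^ Fintype.card V * M ^ E.card := by
  refine (Finset.abs_sum_le_sum_abs _ _).trans ?_
  refine (Finset.sum_le_sum fun k _ => abs_prod_edges_le hM k E).trans ?_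
  simp

lemma pow_le_edgeSum_idMat {n : ℕ} (E : Multiset (V × V)) (W : Finset V) (hW : W.Nonempty)
    (hE : ∀ e ∈ E, e.1 ∈ W ∧ e.2 ∈ W) :
    (n : ℝ) ^ (Wᶜ.card + 1) ≤ edgeSum (idMat n) E := by
  let F : ({y // y ∈ Wᶜ} → Fin n) × Fin n → V → Fin n :=
    fun q y => if h : y ∈ Wᶜ then q.1 ⟨y, h⟩ else q.2
  have hF : Function.Injective F := by
    rintro ⟨f, c⟩ ⟨f', c'⟩ h
    obtain ⟨y, hy⟩ := hW
    refine Prod.ext (funext fun z => ?_) ?_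
    · have := congrFun h z.1
      simpa only [F, dif_pos z.2] using this
    · have := congrFun h y
      simpa [F, hy] using this
  have hone : ∀ q, (E.map fun e => idMat n (F q e.1) (F q e.2)).prod = 1 := fun q => by
    refine Multiset.prod_eq_one fun a ha => ?_
    obtain ⟨e, he, rfl⟩ := Multiset.mem_map.mp ha
    simp [idMat, F, (hE e he).1, (hE e he).2]
  calc (n : ℝ) ^ (Wᶜ.card + 1)
      = ∑ q : ({y // y ∈ Wᶜ} → Fin n) × Fin n,
          (E.map fun e => idMat n (F q e.1) (F q e.2)).prod := by
        simp only [hone]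
        simp only [Finset.sum_const, Finset.card_univ, Fintype.card_prod, Fintype.card_fun,
          Fintype.card_fin, Fintype.card_coe, nsmul_eq_mul, mul_one, pow_succ]
        push_cast
        rfl
    _ = ∑ k ∈ Finset.univ.map ⟨F, hF⟩, (E.map fun e => idMat n (k e.1) (k e.2)).prod := by
        simp
    _ ≤ edgeSum (idMat n) E := by
        refine Finset.sum_le_sum_of_subset_of_nonneg (Finset.subset_univ _) fun k _ _ => ?_
        refine Multiset.prod_nonneg fun a ha => ?_
        obtain ⟨e, -, rfl⟩ := Multiset.mem_map.mp ha
        unfold idMat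
        split_ifs <;> norm_num

lemma four_mul_card_toFinset_le {α : Type} [DecidableEq α] (s : Multiset α)
    (hs : ∀ a ∈ s, 4 ≤ s.count a) : 4 * s.toFinset.card ≤ s.card := by
  rw [← Multiset.toFinset_sum_count_eq, mul_comm, ← smul_eq_mul]
  exact Finset.card_nsmul_le_sum _ _ _ fun a ha => hs a (Multiset.mem_toFinset.mp ha)

lemma even_count_of_sum_eq_zero {α : Type} [DecidableEq α] (s : Multiset α) (a : α)
    (hs : (s.map fun b => if b = a then (1 : ZMod 2) else 0).sum = 0) : Even (s.count a) := by
  rw [← ZMod.natCast_eq_zero_iff_even, ← hs]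
  clear hs
  induction s using Multiset.induction_on with
  | empty => simp
  | cons b s ih =>
    rw [Multiset.count_cons, Multiset.map_cons, Multiset.sum_cons, ← ih]
    by_cases h : b = a
    · simp [h, add_comm]
    · simp [h, Ne.symm h]

lemma four_le_count {α : Type} [DecidableEq α] {s : Multiset α} {a : α} (ha : a ∈ s)
    (h : Even (s.count a)) (h2 : s.count a ≠ 2) : 4 ≤ s.count a := by
  have := Multiset.count_pos.mpr ha
  obtain ⟨c, hc⟩ := h
  omega

lemma tendsto_edgeSum_div_zero (E : Multiset (V × V)) (hE0 : E ≠ 0) (hE : HasEvenDegrees E)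
    (h1 : ∀ y, (E.map Prod.fst).count y ≠ 2) (h2 : ∀ y, (E.map Prod.snd).count y ≠ 2)
    {H : ∀ n : ℕ, Fin n → Fin n → ℝ} (hH : IsDelocalized H) :
    Tendsto (fun n => edgeSum (H n) E / edgeSum (idMat n) E) atTop (nhds 0) := by
  set W : Finset V := (E.map Prod.fst).toFinset ∪ (E.map Prod.snd).toFinset with hWdef
  have hA := four_mul_card_toFinset_le (E.map Prod.fst) fun a ha =>
    four_le_count ha (even_count_of_sum_eq_zero _ _ (by
      rw [Multiset.map_map]; exact (hE fun b => if b = a then 1 else 0).1)) (h1 a)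
  have hB := four_mul_card_toFinset_le (E.map Prod.snd) fun a ha =>
    four_le_count ha (even_count_of_sum_eq_zero _ _ (by
      rw [Multiset.map_map]; exact (hE fun b => if b = a then 1 else 0).2)) (h2 a)
  have hW2 : 2 * W.card ≤ E.card := by
    have := Finset.card_union_le (E.map Prod.fst).toFinset (E.map Prod.snd).toFinset
    rw [← hWdef] at this
    rw [Multiset.card_map] at hA hB
    omega
  have hEW : ∀ e ∈ E, e.1 ∈ W ∧ e.2 ∈ W := fun e he => by
    simp only [hWdef, Finset.mem_union, Multiset.mem_toFinset]
    exact ⟨Or.inl (Multiset.mem_map_of_mem _ he), Or.inr (Multiset.mem_map_of_mem _ he)⟩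
  obtain ⟨e₀, he₀⟩ := Multiset.exists_mem_of_ne_zero hE0
  have hWne : W.Nonempty := ⟨_, (hEW e₀ he₀).1⟩
  have hEpos : (0 : ℝ) < E.card := by
    exact_mod_cast Multiset.card_pos.mpr hE0
  have hWc : Wᶜ.card + W.card = Fintype.card V := by
    rw [Finset.card_compl]
    have := Finset.card_le_univ W
    omega
  have hlim : Tendsto (fun n : ℕ => (n : ℝ) ^ (-(1 / 2 : ℝ))) atTop (nhds 0) :=
    (tendsto_rpow_neg_atTop (by norm_num)).comp tendsto_natCast_atTop_atTop
  refine squeeze_zero_norm' ?_ hlim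
  filter_upwards [hH.2 (1 / (2 * E.card)) (by positivity), eventually_ge_atTop 1] with n hn hn1
  have hn1' : (1 : ℝ) ≤ n := by exact_mod_cast hn1
  have hn0 : (0 : ℝ) < n := by linarith
  have hlow := pow_le_edgeSum_idMat (n := n) E W hWne hEW
  have hup := abs_edgeSum_le (fun i j => (hn i j).le) E
  have hpow : (0 : ℝ) < (n : ℝ) ^ (Wᶜ.card + 1) := by positivity
  rw [Real.norm_eq_abs, abs_div, abs_of_pos (hpow.trans_le hlow),
    div_le_iff₀ (hpow.trans_le hlow)]
  refine le_trans ?_ (mul_le_mul_of_nonneg_left hlow (by positivity))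
  refine hup.trans ?_
  rw [← Real.rpow_natCast, ← Real.rpow_natCast, ← Real.rpow_natCast, ← Real.rpow_mul hn0.le,
    ← Real.rpow_add hn0, ← Real.rpow_add hn0]
  refine Real.rpow_le_rpow_of_exponent_le hn1' ?_
  have hWc' : (Wᶜ.card : ℝ) + W.card = Fintype.card V := by exact_mod_cast hWc
  have hW2' : 2 * (W.card : ℝ) ≤ E.card := by exact_mod_cast hW2
  have : (-(1 / 2 : ℝ) + 1 / (2 * E.card)) * E.card = -(E.card : ℝ) / 2 + 1 / 2 := by
    field_simp
  rw [this, ← hWc']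
  push_cast
  linarith

/-- The normalized edge sums converge to a common limit in `{0, 1}` for all delocalized
sequences of orthogonal matrices. -/
def HasUniversalLimit (E : Multiset (V × V)) : Prop :=
  ∃ L : ℝ, (L = 0 ∨ L = 1) ∧ ∀ H : ∀ n : ℕ, Fin n → Fin n → ℝ, IsDelocalized H →
    Tendsto (fun n => edgeSum (H n) E / edgeSum (idMat n) E) atTop (nhds L)

lemma HasUniversalLimit.of_mul_pow {E E' : Multiset (V × V)} (h : HasUniversalLimit E')
    (hEE' : ∃ j : ℕ, ∀ (n : ℕ) (H : Fin n → Fin n → ℝ), isOrthogonalMat H →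
      edgeSum H E * (n : ℝ) ^ j = edgeSum H E') : HasUniversalLimit E := by
  obtain ⟨L, hL, h⟩ := h
  obtain ⟨j, hj⟩ := hEE'
  refine ⟨L, hL, fun H hH => (h H hH).congr' ?_⟩
  filter_upwards [eventually_ge_atTop 1] with n hn
  have hn0 : (n : ℝ) ≠ 0 := by exact_mod_cast (by omega : n ≠ 0)
  rw [← hj n _ (hH.1 n), ← hj n _ (isOrthogonalMat_idMat n),
    mul_div_mul_right _ _ (pow_ne_zero _ hn0)]

lemma HasUniversalLimit.of_swap {E : Multiset (V × V)}
    (h : HasUniversalLimit (E.map Prod.swap)) : HasUniversalLimit E := by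
  obtain ⟨L, hL, h⟩ := h
  refine ⟨L, hL, fun H hH => (h _ hH.transpose).congr fun n => ?_⟩
  rw [edgeSum_map_swap, ← edgeSum_map_swap (idMat n) E, idMat_transpose]

lemma hasUniversalLimit_zero : HasUniversalLimit (0 : Multiset (V × V)) := by
  refine ⟨1, Or.inr rfl, fun H _ => tendsto_const_nhds.congr' ?_⟩
  filter_upwards [eventually_ge_atTop 1] with n hn
  have hn0 : (n : ℝ) ≠ 0 := by exact_mod_cast (by omega : n ≠ 0)
  simp [edgeSum, hn0]

/-- One contraction step at a vertex that is the second endpoint of exactly two edges. -/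
lemma HasUniversalLimit.of_count_snd_eq_two (E : Multiset (V × V)) (p : V → Prop)
    (hp : ∀ e ∈ E, p e.1 ∧ ¬ p e.2) (hE : HasEvenDegrees E) {x : V}
    (hx : (E.map Prod.snd).count x = 2)
    (ih : ∀ E' : Multiset (V × V), E'.card < E.card → ∀ p : V → Prop,
      (∀ e ∈ E', p e.1 ∧ ¬ p e.2) → HasEvenDegrees E' → HasUniversalLimit E') :
    HasUniversalLimit E := by
  obtain ⟨u, v, R, rfl, hR⟩ := exists_eq_cons_cons hx
  have hpu := hp (u, x) (by simp)
  have hpv := hp (v, x) (by simp)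
  have hpR : ∀ e ∈ R, p e.1 ∧ ¬ p e.2 := fun e he => hp e (by simp [he])
  have hux : u ≠ x := fun h => hpu.2 (h ▸ hpu.1)
  have hvx : v ≠ x := fun h => hpv.2 (h ▸ hpv.1)
  refine (ih (R.map (Prod.map (Function.update id v u) (Function.update id v u)))
    (by simp) p ?_ ?_).of_mul_pow (exists_edgeSum_contract R u v x hux hvx fun e he =>
      ⟨fun h => hpu.2 (h ▸ (hpR e he).1), hR e he⟩)
  · have hpφ : ∀ y, p (Function.update id v u y) ↔ p y := fun y => by
      by_cases hy : y = v
      · subst hy; simp [hpu.1, hpv.1]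
      · simp [hy]
    intro e he
    obtain ⟨e', he', rfl⟩ := Multiset.mem_map.mp he
    simpa [hpφ] using hpR e' he'
  · intro g
    have hg := hE fun y => g (Function.update id v u y)
    have huφ : Function.update id v u u = u := by
      by_cases huv : u = v
      · subst huv; simp
      · simp [huv]
    simp only [Multiset.map_cons, Multiset.sum_cons, Function.update_self, huφ, ← add_assoc,
      CharTwo.add_self_eq_zero, zero_add] at hg
    simpa [Multiset.map_map] using hg

lemma hasUniversalLimit_of_hasEvenDegrees (E : Multiset (V × V)) (p : V → Prop)
    (hp : ∀ e ∈ E, p e.1 ∧ ¬ p e.2) (hE : HasEvenDegrees E) : HasUniversalLimit E := by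
  induction hN : E.card using Nat.strong_induction_on generalizing E p with
  | _ N ih =>
  subst hN
  by_cases h2 : ∃ x, (E.map Prod.snd).count x = 2
  · obtain ⟨x, hx⟩ := h2
    exact .of_count_snd_eq_two E p hp hE hx fun E' hE' p' hp' hev => ih _ hE' E' p' hp' hev rfl
  by_cases h1 : ∃ x, (E.map Prod.fst).count x = 2
  · obtain ⟨x, hx⟩ := h1
    refine .of_swap (.of_count_snd_eq_two _ (fun y => ¬ p y) ?_ hE.swap (x := x) ?_
      fun E' hE' p' hp' hev => ih _ (by simpa using hE') E' p' hp' hev rfl)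
    · intro e he
      obtain ⟨e', he', rfl⟩ := Multiset.mem_map.mp he
      simpa [and_comm] using hp e' he'
    · simpa [Multiset.map_map] using hx
  push Not at h1 h2
  by_cases h0 : E = 0
  · exact h0 ▸ hasUniversalLimit_zero
  · exact ⟨0, Or.inl rfl, fun H hH => tendsto_edgeSum_div_zero E h0 hE h1 h2 hH⟩

end

/-- The setoid of a `Bool`-valued equivalence relation. -/
def IsPartitionRel.toSetoid {m : ℕ} {r : Fin m → Fin m → Bool} (h : IsPartitionRel r) :
    Setoid (Fin m) where
  r a b := r a b = true
  iseqv := ⟨h.1, fun {a b} hab => h.2.1 a b ▸ hab, fun {a b c} => h.2.2 a b c⟩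

lemma sum_filter_eq_sum_quotient {α M : Type} [AddCommMonoid M] [Fintype α] {m : ℕ}
    {r : Fin m → Fin m → Bool} (s : Setoid (Fin m)) (hs : ∀ a b, s a b ↔ r a b = true)
    [Fintype (Quotient s)] [DecidableEq (Quotient s)] [DecidableEq α]
    (f : (Fin m → α) → M) :
    ∑ k ∈ Finset.univ.filter (fun k : Fin m → α => ∀ a b, r a b = true → k a = k b), f k =
      ∑ k : Quotient s → α, f fun a => k (Quotient.mk s a) := by
  symm
  refine Finset.sum_bij (fun k _ a => k (Quotient.mk s a)) ?_ ?_ ?_ ?_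
  · intro k _
    simp only [Finset.mem_filter, Finset.mem_univ, true_and]
    exact fun a b hab => congrArg k (Quotient.sound ((hs a b).mpr hab))
  · intro k _ k' _ h
    funext q
    induction q using Quotient.inductionOn with
    | _ a => exact congrFun h a
  · intro k hk
    simp only [Finset.mem_filter, Finset.mem_univ, true_and] at hk
    exact ⟨Quotient.lift k fun a b hab => hk a b ((hs a b).mp hab), Finset.mem_univ _, rfl⟩
  · intros; rfl

/-- The partition-constrained double sum attached to `r` and `r'`. -/
def partitionSum {m n : ℕ} (r r' : Fin m → Fin m → Bool) (H : Fin n → Fin n → ℝ) : ℝ :=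
  ∑ kk ∈ Finset.univ.filter (fun kk : Fin m → Fin n => ∀ ρ ρ', r ρ ρ' = true → kk ρ = kk ρ'),
    ∑ ll ∈ Finset.univ.filter (fun ll : Fin m → Fin n => ∀ ρ ρ', r' ρ ρ' = true → ll ρ = ll ρ'),
      ∏ ρ : Fin m, H (kk ρ) (ll ρ)

open Classical in
lemma partitionSum_idMat {m n : ℕ} (r r' : Fin m → Fin m → Bool) :
    partitionSum r r' (idMat n) = (n : ℝ) ^ joinCard r r' := by
  have h : ∀ kk ll : Fin m → Fin n,
      ∏ ρ, idMat n (kk ρ) (ll ρ) = if kk = ll then (1 : ℝ) else 0 := fun kk ll => by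
    simp [idMat, Finset.prod_ite_zero, funext_iff]
  simp only [partitionSum, h, Finset.sum_ite_eq, Finset.mem_filter, Finset.mem_univ, true_and]
  rw [← Finset.sum_filter, Finset.filter_filter, Finset.sum_const, nsmul_one, joinCard]
  norm_cast
  let t : Fin m → Fin m → Prop := fun a b => r a b = true ∨ r' a b = true
  have e : (Quot t → Fin n) ≃ {k : Fin m → Fin n //
      (∀ a b, r a b = true → k a = k b) ∧ ∀ a b, r' a b = true → k a = k b} :=
    { toFun := fun k => ⟨fun a => k (Quot.mk t a),
        fun a b hab => congrArg k (Quot.sound (Or.inl hab)),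
        fun a b hab => congrArg k (Quot.sound (Or.inr hab))⟩
      invFun := fun k => Quot.lift k.1 fun a b hab => hab.elim (k.2.1 a b) (k.2.2 a b)
      left_inv := fun k => by
        funext q
        induction q using Quot.inductionOn with
        | _ a => rfl
      right_inv := fun k => rfl }
  rw [← Fintype.card_subtype, ← Nat.card_eq_fintype_card, ← Nat.card_congr e, Nat.card_fun]
  simp [t]

lemma sum_comp_quotient_eq_zero {m : ℕ} {r : Fin m → Fin m → Bool} (h : IsPartitionRel r)
    (heven : ∀ a, Even (Finset.univ.filter fun b => r a b = true).card)
    (g : Quotient h.toSetoid → ZMod 2) :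
    ∑ a, g (Quotient.mk h.toSetoid a) = 0 := by
  classical
  rw [← Finset.sum_fiberwise Finset.univ (Quotient.mk h.toSetoid)]
  refine Finset.sum_eq_zero fun q _ => ?_
  rw [Finset.sum_congr rfl (g := fun _ => g q) fun a ha => by rw [(Finset.mem_filter.mp ha).2]]
  induction q using Quotient.inductionOn with
  | _ a =>
  have : (Finset.univ.filter fun b => Quotient.mk h.toSetoid b = Quotient.mk h.toSetoid a) =
      Finset.univ.filter fun b => r a b = true := by
    ext b
    simp only [Finset.mem_filter, Finset.mem_univ, true_and, eq_comm (b := Quotient.mk _ a)]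
    exact Quotient.eq
  rw [this, Finset.sum_const, nsmul_eq_mul, ZMod.natCast_eq_zero_iff_even.mpr (heven a), zero_mul]

/-- **A limit for partition-constrained sums of products of entries of delocalized
orthogonal matrices.**  For any `w ≥ 1` and even partitions `σ, σ'` of `{1, …, 2w}`,
there is a value `H(σ,σ') ∈ {0,1}`, depending only on `σ` and `σ'` and not on the matrix
sequence, such that for every sequence of orthogonal matrices `H n` with
`max_{i,j} |H[i,j]| < n^{−1/2+ε}` for all large `n` (for every fixed `ε > 0`),
`n^{−|σ∨σ'|} ∑_{π(k) ≥ σ} ∑_{π(l) ≥ σ'} ∏_ρ H[k_ρ, l_ρ] → H(σ,σ')`. -/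
theorem orthogonal_partition_sum_limit (w : ℕ) (hw : 1 ≤ w)
    (σ σ' : Fin (2 * w) → Fin (2 * w) → Bool)
    (hσ : IsPartitionRel σ) (hσ' : IsPartitionRel σ')
    (heven : ∀ a, Even (Finset.univ.filter fun b => σ a b = true).card)
    (heven' : ∀ a, Even (Finset.univ.filter fun b => σ' a b = true).card) :
    ∃ L : ℝ, (L = 0 ∨ L = 1) ∧
      ∀ H : ∀ n : ℕ, Fin n → Fin n → ℝ,
        (∀ n : ℕ, isOrthogonalMat (H n)) →
        (∀ ε : ℝ, 0 < ε → ∀ᶠ n in atTop, ∀ i j : Fin n,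
          |H n i j| < (n : ℝ) ^ (-(1 / 2 : ℝ) + ε)) →
        Tendsto (fun n : ℕ =>
            ((n : ℝ) ^ joinCard σ σ')⁻¹ *
              ∑ kk ∈ Finset.univ.filter
                  (fun kk : Fin (2 * w) → Fin n =>
                    ∀ ρ ρ', σ ρ ρ' = true → kk ρ = kk ρ'),
                ∑ ll ∈ Finset.univ.filter
                    (fun ll : Fin (2 * w) → Fin n =>
                      ∀ ρ ρ', σ' ρ ρ' = true → ll ρ = ll ρ'),
                  ∏ ρ : Fin (2 * w), H n (kk ρ) (ll ρ))
          atTop (nhds L) := by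
  classical
  let V := Quotient hσ.toSetoid ⊕ Quotient hσ'.toSetoid
  let E : Multiset (V × V) := Finset.univ.val.map fun ρ : Fin (2 * w) =>
    (Sum.inl (Quotient.mk hσ.toSetoid ρ), Sum.inr (Quotient.mk hσ'.toSetoid ρ))
  have hS : ∀ {n : ℕ} (H : Fin n → Fin n → ℝ), partitionSum σ σ' H = edgeSum H E := by
    intro n H
    rw [partitionSum, sum_filter_eq_sum_quotient hσ.toSetoid fun _ _ => Iff.rfl, edgeSum,
      ← (Equiv.sumArrowEquivProdArrow _ _ _).symm.sum_comp, Fintype.sum_prod_type]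
    refine Finset.sum_congr rfl fun k _ => ?_
    rw [sum_filter_eq_sum_quotient hσ'.toSetoid fun _ _ => Iff.rfl]
    refine Finset.sum_congr rfl fun l _ => ?_
    rw [Multiset.map_map]
    rfl
  obtain ⟨L, hL, h⟩ := hasUniversalLimit_of_hasEvenDegrees E (fun y => y.isLeft = true)
    (fun e he => by
      obtain ⟨ρ, -, rfl⟩ := Multiset.mem_map.mp he
      simp)
    (fun g => by
      simp only [E, Multiset.map_map]
      exact ⟨sum_comp_quotient_eq_zero hσ heven fun q => g (Sum.inl q),
        sum_comp_quotient_eq_zero hσ' heven' fun q => g (Sum.inr q)⟩)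
  refine ⟨L, hL, fun H hH hdel => (h H ⟨hH, hdel⟩).congr fun n => ?_⟩
  rw [← hS, ← hS, partitionSum_idMat, div_eq_inv_mul]
  rfl

end
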